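/- arXiv:hep-th/9211109 — 2 statements merged into one kernel-verified Lean document; each statement's English description precedes it below -/
import Mathlib

section
/- Let g be a finite-dimensional semisimple Lie algebra over ℂ and let (h, e, f) be an sl₂ triple in g, i.e. ⁅h,e⁆ = 2e, ⁅h,f⁆ = −2f, ⁅e,f⁆ = h. Then g decomposes as the direct sum of subspaces g = (Ker(ad e) + Ker(ad f)) ⊕ (Im(ad e) ∩ Im(ad f)), and the two summands are orthogonal to each other with respect to the Killing form of g: κ(x, y) = 0 for all x ∈ Ker(ad e) + Ker(ad f) and all y ∈ Im(ad e) ∩ Im(ad f). -/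
open LieAlgebra

open Polynomial in
/-- A vector killed by two split polynomials in `H` without common roots is zero. -/
lemma Module.End.eq_zero_of_aeval_prod_eq_zero {K V ι κ : Type*} [Field K] [AddCommGroup V]
    [Module K V] (H : Module.End K V) {s : Finset ι} {t : Finset κ} {a : ι → K} {b : κ → K}
    (hab : ∀ i ∈ s, ∀ j ∈ t, a i ≠ b j) {v : V}
    (hs : aeval H (∏ i ∈ s, (X - C (a i))) v = 0)
    (ht : aeval H (∏ j ∈ t, (X - C (b j))) v = 0) : v = 0 := by
  have hco : IsCoprime (∏ i ∈ s, (X - C (a i))) (∏ j ∈ t, (X - C (b j))) :=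
    IsCoprime.prod_left fun i hi ↦ IsCoprime.prod_right fun j hj ↦
      isCoprime_X_sub_C_of_isUnit_sub (sub_ne_zero.mpr (hab i hi j hj)).isUnit
  obtain ⟨p, q, hpq⟩ := hco
  have := congrArg (fun r ↦ aeval H r v) hpq
  simpa [-map_prod, hs, ht] using this.symm

open Polynomial in
lemma Module.End.aeval_mem_of_mapsTo {K V : Type*} [CommSemiring K] [AddCommMonoid V]
    [Module K V] {H : Module.End K V} {W : Submodule K V} (hW : Set.MapsTo H W W) (p : K[X]) {x : V}
    (hx : x ∈ W) : aeval H p x ∈ W := by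
  rw [aeval_eq_sum_range, LinearMap.sum_apply]
  refine W.sum_mem fun i _ ↦ W.smul_mem _ ?_
  rw [Module.End.pow_apply]
  exact hW.iterate i hx

/-- An endomorphism scaled by a nonzero factor under bracketing with `H` is nilpotent. -/
lemma Module.End.isNilpotent_of_commutator_eq_smul {K V : Type*} [Field K] [CharZero K]
    [AddCommGroup V] [Module K V] [FiniteDimensional K V] {H E : Module.End K V} {c : K}
    (hc : c ≠ 0) (hE : H * E - E * H = c • E) : IsNilpotent E := by
  by_contra hnil
  have hpow (n : ℕ) : H * E ^ n - E ^ n * H = (n * c) • E ^ n := by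
    induction n with
    | zero => simp
    | succ n ih =>
      have : H * E ^ (n + 1) - E ^ (n + 1) * H
          = (H * E ^ n - E ^ n * H) * E + E ^ n * (H * E - E * H) := by
        rw [pow_succ]; noncomm_ring
      rw [this, ih, hE, smul_mul_assoc, mul_smul_comm, ← pow_succ]
      push_cast
      module
  let T : Module.End K (Module.End K V) := LinearMap.mulLeft K H - LinearMap.mulRight K H
  have hev (n : ℕ) : T.HasEigenvalue (n * c) :=
    Module.End.hasEigenvalue_of_hasEigenvector (x := E ^ n)
      ⟨Module.End.mem_eigenspace_iff.mpr (by simpa [T] using hpow n), fun h0 ↦ hnil ⟨n, h0⟩⟩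
  have hinj : Function.Injective fun n : ℕ ↦ (n * c : K) := fun m n hmn ↦ by
    simpa [hc] using hmn
  exact Set.infinite_range_of_injective hinj
    ((Module.End.finite_hasEigenvalue T).subset (Set.range_subset_iff.mpr hev))

/-- The relations satisfied by the action of an `sl₂` triple on a module, up to a sign `c`;
exchanging `E` and `F` changes the sign. -/
structure Sl2Relations {K V : Type*} [Field K] [AddCommGroup V] [Module K V]
    (H E F : Module.End K V) (c : K) : Prop where
  sign : c = 1 ∨ c = -1
  h_e : ∀ v, H (E v) = E (H v) + (2 * c) • E v
  h_f : ∀ v, H (F v) = F (H v) - (2 * c) • F v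
  e_f : ∀ v, E (F v) = F (E v) + c • H v

namespace Sl2Relations

open Polynomial

variable {K V : Type*} [Field K] [AddCommGroup V] [Module K V]
  {H E F : Module.End K V} {c : K}

lemma sign_ne_zero (t : Sl2Relations H E F c) : c ≠ 0 := by
  rcases t.sign with rfl | rfl <;> simp

lemma symm (t : Sl2Relations H E F c) : Sl2Relations H F E (-c) where
  sign := by rcases t.sign with rfl | rfl <;> simp
  h_e v := by rw [t.h_f]; module
  h_f v := by rw [t.h_e]; module
  e_f v := by rw [t.e_f]; module

lemma f_pow_e (t : Sl2Relations H E F c) (n : ℕ) (v : V) :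
    F ((E ^ (n + 1)) v) =
      (E ^ n) (F (E v) - (n * c) • H v - ((n : K) * (n + 1)) • v) := by
  induction n generalizing v with
  | zero => simp
  | succ n ih =>
    have hFEE : F (E (E v)) = E (F (E v)) - c • H (E v) := by rw [t.e_f (E v)]; module
    rw [pow_succ, Module.End.mul_apply, ih, pow_succ, Module.End.mul_apply, hFEE, t.h_e]
    congr 1
    simp only [map_sub, map_smul]
    rcases t.sign with rfl | rfl <;> push_cast <;> module

lemma aeval_prod_eq_zero_of_f_pow_e_pow [CharZero K] (t : Sl2Relations H E F c) (n : ℕ) (v : V)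
    (hv : E (F v) = 0) (hn : (F ^ n) ((E ^ n) v) = 0) :
    aeval H (∏ j ∈ Finset.range n, (X - C (-(c * j)))) v = 0 := by
  induction n generalizing v with
  | zero => simpa using hn
  | succ n ih =>
    have hFE : F (E v) = -(c • H v) := by
      rw [t.e_f] at hv
      exact eq_neg_of_add_eq_zero_left hv
    have hstep : F (E v) - (n * c) • H v - ((n : K) * (n + 1)) • v
        = (-((n + 1) * c)) • (H v + (c * n) • v) := by
      rw [hFE]
      rcases t.sign with rfl | rfl <;> module
    rw [pow_succ F, Module.End.mul_apply, t.f_pow_e, hstep, map_smul, map_smul, smul_eq_zero,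
      neg_eq_zero, mul_eq_zero] at hn
    have hn' := (hn.resolve_left (not_or.mpr ⟨Nat.cast_add_one_ne_zero n, t.sign_ne_zero⟩))
    have hHv : E (F (H v + (c * n) • v)) = 0 := by
      have : F (H v) = H (F v) + (2 * c) • F v := by rw [t.h_f]; module
      have h2 : E (H (F v)) = H (E (F v)) - (2 * c) • E (F v) := by rw [t.h_e]; module
      simp [this, h2, hv]
    have hlin : H v + (c * n) • v = aeval H (X - C (-(c * n))) v := by
      simp [Algebra.algebraMap_eq_smul_one, mul_smul, Nat.cast_smul_eq_nsmul]
    rw [Finset.prod_range_succ, map_mul, Module.End.mul_apply, ← hlin]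
    exact ih _ hHv hn'

/-- The weights occurring in `ker (E ∘ F)` are non-positive. -/
lemma exists_aeval_prod_eq_zero [CharZero K] [FiniteDimensional K V] (t : Sl2Relations H E F c)
    {v : V} (hv : E (F v) = 0) :
    ∃ n : ℕ, aeval H (∏ j ∈ Finset.range n, (X - C (-(c * j)))) v = 0 := by
  have hc : 2 * c ≠ 0 := mul_ne_zero two_ne_zero t.sign_ne_zero
  obtain ⟨n, hn⟩ := Module.End.isNilpotent_of_commutator_eq_smul (H := H) (E := E) hc
    (by ext v; simp [t.h_e])
  exact ⟨n, t.aeval_prod_eq_zero_of_f_pow_e_pow n v hv (by simp [hn])⟩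

lemma aeval_f (t : Sl2Relations H E F c) {ι : Type*} (s : Finset ι) (a : ι → K) (v : V) :
    aeval H (∏ i ∈ s, (X - C (a i - 2 * c))) (F v) = F (aeval H (∏ i ∈ s, (X - C (a i))) v) := by
  classical
  induction s using Finset.induction_on generalizing v with
  | empty => simp
  | insert i s hi ih =>
    have hF : aeval H (X - C (a i - 2 * c)) (F v) = F (aeval H (X - C (a i)) v) := by
      simp [t.h_f, Algebra.algebraMap_eq_smul_one]
      module
    rw [Finset.prod_insert hi, Finset.prod_insert hi, mul_comm, mul_comm (X - C (a i)), map_mul,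
      map_mul, Module.End.mul_apply, Module.End.mul_apply, hF, ih]

lemma disjoint_ker_range [CharZero K] [FiniteDimensional K V] (t : Sl2Relations H E F c) :
    Disjoint (LinearMap.ker E) (LinearMap.range F) := by
  rw [Submodule.disjoint_def]
  rintro _ hx ⟨v, rfl⟩
  rw [LinearMap.mem_ker] at hx
  obtain ⟨m, hm⟩ := t.exists_aeval_prod_eq_zero hx
  obtain ⟨n, hn⟩ := t.symm.exists_aeval_prod_eq_zero (v := F v) (by rw [hx, map_zero])
  have hm' := t.aeval_f (Finset.range m) (fun j ↦ -(c * j)) v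
  rw [hm, map_zero] at hm'
  refine Module.End.eq_zero_of_aeval_prod_eq_zero H (fun i _ j _ hij ↦ ?_) hm' hn
  have : ((i + j + 2 : ℕ) : K) = 0 := by
    refine (mul_eq_zero.mp ?_).resolve_left t.sign_ne_zero
    push_cast
    linear_combination -hij
  norm_cast at this

lemma aeval_mem_ker (t : Sl2Relations H E F c) (p : K[X]) {x : V} (hx : E x = 0) :
    E (aeval H p x) = 0 :=
  Module.End.aeval_mem_of_mapsTo (W := LinearMap.ker E) (fun y hy ↦ by
    have := t.h_e y
    simp_all) p hx

lemma aeval_mem_range (t : Sl2Relations H E F c) (p : K[X]) {x : V}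
    (hx : x ∈ LinearMap.range F) : aeval H p x ∈ LinearMap.range F :=
  Module.End.aeval_mem_of_mapsTo (by
    rintro _ ⟨y, rfl⟩
    exact ⟨H y - (2 * c) • y, by rw [t.h_f, map_sub, map_smul]⟩) p hx

/-- A vector of weight zero killed by `E` is also killed by `F`. -/
lemma f_eq_zero [CharZero K] [FiniteDimensional K V] (t : Sl2Relations H E F c) {x : V}
    (hE : E x = 0) (hH : H x = 0) : F x = 0 :=
  Submodule.disjoint_def.mp t.disjoint_ker_range _ (by simp [t.e_f, hE, hH]) ⟨x, rfl⟩

lemma disjoint_ker_sup_ker [CharZero K] [FiniteDimensional K V] (t : Sl2Relations H E F c) :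
    Disjoint (LinearMap.ker E ⊔ LinearMap.ker F) (LinearMap.range E ⊓ LinearMap.range F) := by
  rw [Submodule.disjoint_def]
  rintro w hw ⟨hwE, hwF⟩
  obtain ⟨x, hx, y, hy, rfl⟩ := Submodule.mem_sup.mp hw
  rw [LinearMap.mem_ker] at hx hy
  obtain ⟨m, hm⟩ := t.exists_aeval_prod_eq_zero (v := y) (by rw [hy, map_zero])
  obtain ⟨n, hn⟩ := t.symm.exists_aeval_prod_eq_zero (v := x) (by rw [hx, map_zero])
  have hxm : aeval H (∏ j ∈ Finset.range m, (X - C (-(c * j)))) x = 0 := by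
    refine Submodule.disjoint_def.mp t.disjoint_ker_range _ (t.aeval_mem_ker _ hx) ?_
    have := t.aeval_mem_range (∏ j ∈ Finset.range m, (X - C (-(c * j)))) hwF
    rwa [map_add, hm, add_zero] at this
  have hHx : H x = 0 := by
    cases n with
    | zero =>
      have : x = 0 := by simpa using hn
      rw [this, map_zero]
    | succ n =>
      have hX : aeval H (X : K[X]) x = H x := by simp
      rw [Finset.prod_range_succ', Nat.cast_zero, mul_zero, neg_zero, C_0, sub_zero, map_mul,
        Module.End.mul_apply, hX] at hn
      refine Module.End.eq_zero_of_aeval_prod_eq_zero H (fun i _ j _ hij ↦ ?_) ?_ hn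
        (s := Finset.range m) (a := fun i ↦ -(c * i))
      · have : ((i + j + 1 : ℕ) : K) = 0 := by
          refine (mul_eq_zero.mp ?_).resolve_left t.sign_ne_zero
          push_cast at hij ⊢
          linear_combination -hij
        norm_cast at this
      · rw [← hX, ← Module.End.mul_apply, ← map_mul, mul_comm, map_mul, Module.End.mul_apply, hxm,
          map_zero]
  exact Submodule.disjoint_def.mp t.symm.disjoint_ker_range _
    (by simp [t.f_eq_zero hx hHx, hy]) hwE

end Sl2Relations

lemma LieAlgebra.orthogonal_range_ad {K L : Type*} [Field K] [LieRing L] [LieAlgebra K L]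
    [FiniteDimensional K L] [LieAlgebra.IsKilling K L] (x : L) :
    (killingForm K L).orthogonal (LinearMap.range (ad K L x)) = LinearMap.ker (ad K L x) := by
  ext y
  have hinv (z : L) : killingForm K L ⁅x, z⁆ y = -killingForm K L z ⁅x, y⁆ := by
    rw [← lie_skew, map_neg, LinearMap.neg_apply, LieModule.traceForm_apply_lie_apply]
  simp only [LinearMap.BilinForm.mem_orthogonal_iff,
    LinearMap.mem_range, forall_exists_index, forall_apply_eq_imp_iff, ad_apply, hinv,
    neg_eq_zero, LinearMap.mem_ker]
  exact ⟨(IsKilling.killingForm_nondegenerate K L).2 _, fun h z ↦ by rw [h, map_zero]⟩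

lemma LieAlgebra.orthogonal_ker_ad {K L : Type*} [Field K] [LieRing L] [LieAlgebra K L]
    [FiniteDimensional K L] [LieAlgebra.IsKilling K L] (x : L) :
    (killingForm K L).orthogonal (LinearMap.ker (ad K L x)) = LinearMap.range (ad K L x) := by
  rw [← LieAlgebra.orthogonal_range_ad, LinearMap.BilinForm.orthogonal_orthogonal
    (IsKilling.killingForm_nondegenerate K L) (LieModule.traceForm_isSymm K L L).isRefl]

lemma LinearMap.BilinForm.orthogonal_sup {K V : Type*} [CommRing K] [AddCommGroup V] [Module K V]
    (B : LinearMap.BilinForm K V) (U W : Submodule K V) :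
    B.orthogonal (U ⊔ W) = B.orthogonal U ⊓ B.orthogonal W := by
  refine le_antisymm (le_inf (orthogonal_le le_sup_left) (orthogonal_le le_sup_right)) ?_
  rintro y ⟨hU, hW⟩ x hx
  obtain ⟨u, hu, w, hw, rfl⟩ := Submodule.mem_sup.mp hx
  rw [map_add, LinearMap.add_apply, hU u hu, hW w hw, add_zero]

/-- For an `sl₂` triple `(h, e, f)` in a finite-dimensional complex semisimple Lie algebra `g`,
`g = (Ker(ad e) + Ker(ad f)) ⊕ (Im(ad e) ∩ Im(ad f))`, and the two summands are orthogonal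
with respect to the Killing form. -/
theorem sl2_kernel_image_decomposition
    (L : Type*) [LieRing L] [LieAlgebra ℂ L] [FiniteDimensional ℂ L]
    [LieAlgebra.IsSemisimple ℂ L]
    (h e f : L)
    (hhe : ⁅h, e⁆ = (2 : ℂ) • e) (hhf : ⁅h, f⁆ = (-2 : ℂ) • f) (hef : ⁅e, f⁆ = h) :
    IsCompl
        (LinearMap.ker (ad ℂ L e) ⊔ LinearMap.ker (ad ℂ L f))
        (LinearMap.range (ad ℂ L e) ⊓ LinearMap.range (ad ℂ L f)) ∧
      ∀ x ∈ (LinearMap.ker (ad ℂ L e) ⊔ LinearMap.ker (ad ℂ L f) : Submodule ℂ L),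
        ∀ y ∈ (LinearMap.range (ad ℂ L e) ⊓ LinearMap.range (ad ℂ L f) : Submodule ℂ L),
          killingForm ℂ L x y = 0 := by
  have ht : Sl2Relations (ad ℂ L h) (ad ℂ L e) (ad ℂ L f) 1 :=
    { sign := Or.inl rfl
      h_e := fun v ↦ by simp [leibniz_lie h, hhe, add_comm]
      h_f := fun v ↦ by simp [leibniz_lie h, hhf, ← sub_eq_neg_add]
      e_f := fun v ↦ by simp [leibniz_lie e, hef, add_comm] }
  have horth : (killingForm ℂ L).orthogonal
      (LinearMap.ker (ad ℂ L e) ⊔ LinearMap.ker (ad ℂ L f)) =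
        LinearMap.range (ad ℂ L e) ⊓ LinearMap.range (ad ℂ L f) := by
    rw [LinearMap.BilinForm.orthogonal_sup, orthogonal_ker_ad, orthogonal_ker_ad]
  rw [← horth]
  refine ⟨?_, fun x hx y hy ↦ hy x hx⟩
  rw [LinearMap.BilinForm.isCompl_orthogonal_iff_disjoint
    (LieModule.traceForm_isSymm ℂ L L).isRefl, horth]
  exact ht.disjoint_ker_sup_ker
end

section
/- Let g be a finite-dimensional semisimple Lie algebra over ℂ and let (h, e, f) be an sl₂ triple in g. Let C = {x ∈ g : ⁅h,x⁆ = 0, ⁅e,x⁆ = 0, ⁅f,x⁆ = 0} be the centralizer of the triple. Then the restriction of the Killing form of g to C is nondegenerate: for every nonzero x ∈ C there exists y ∈ C with κ(x, y) ≠ 0. -/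
open Module

section Sl2Representation

variable {V : Type*} [AddCommGroup V] [Module ℂ V]

/-- The Casimir operator, suitably normalised, of an `sl₂` triple of endomorphisms. -/
def sl2Casimir (H E F : End ℂ V) : End ℂ V :=
  4 * (F * E) + H * H + 2 * H

variable {H E F : End ℂ V}

theorem sl2Casimir_symm (hEF : E * F - F * E = H) :
    sl2Casimir (-H) F E = sl2Casimir H E F := by
  simp only [sl2Casimir, ← hEF]
  noncomm_ring

theorem commute_sl2Casimir_e (hHE : H * E - E * H = 2 * E) (hEF : E * F - F * E = H) :
    Commute (sl2Casimir H E F) E := by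
  have h₁ : H * E = E * H + 2 * E := by rw [← hHE]; abel
  have h₂ : F * E = E * F - H := by rw [← hEF]; abel
  have h₃ : H * H * E = E * (H * H) + 4 * (E * H) + 4 * E := by
    rw [mul_assoc, h₁, mul_add, ← mul_assoc, h₁, show H * (2 * E) = 2 * (H * E) by noncomm_ring, h₁]
    noncomm_ring
  have h₄ : F * E * E = E * (F * E) - (E * H + 2 * E) := by
    rw [← h₁]; nth_rw 1 [h₂]; noncomm_ring
  rw [Commute, SemiconjBy, sl2Casimir, add_mul, add_mul, mul_assoc 4, h₄, h₃, mul_assoc 2, h₁]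
  noncomm_ring

theorem commute_sl2Casimir_f (hHF : H * F - F * H = -(2 * F)) (hEF : E * F - F * E = H) :
    Commute (sl2Casimir H E F) F := by
  rw [← sl2Casimir_symm hEF]
  refine commute_sl2Casimir_e ?_ ?_
  · rw [← neg_inj, ← hHF]; noncomm_ring
  · rw [← hEF]; abel

theorem hasEigenvalue_add_two {μ : ℂ} {v : V} (hHE : H * E - E * H = 2 * E)
    (hv : H v = μ • v) (hEv : E v ≠ 0) : H.HasEigenvalue (μ + 2) := by
  refine End.hasEigenvalue_of_hasEigenvector (x := E v) ⟨?_, hEv⟩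
  have h₁ := LinearMap.congr_fun hHE v
  simp only [LinearMap.sub_apply, End.mul_apply, hv, map_smul, sub_eq_iff_eq_add] at h₁
  rw [End.mem_eigenspace_iff, h₁, add_smul, add_comm]
  simp [two_smul]

theorem eigenvalue_eq_of_isNilpotent_sl2Casimir {μ : ℂ} {v : V}
    (hC : IsNilpotent (sl2Casimir H E F)) (hv : H v = μ • v) (hv0 : v ≠ 0) (hEv : E v = 0) :
    μ = 0 ∨ μ = -2 := by
  have h₁ : sl2Casimir H E F v = (μ * (μ + 2)) • v := by
    simp [sl2Casimir, hEv, hv, two_mul]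
    module
  obtain ⟨n, hn⟩ := hC
  have h₂ : ∀ k : ℕ, (sl2Casimir H E F ^ k) v = (μ * (μ + 2)) ^ k • v := by
    intro k
    induction k with
    | zero => simp
    | succ k ih => rw [pow_succ, End.mul_apply, h₁, map_smul, ih, smul_smul, pow_succ']
  have h₃ := h₂ n
  rw [hn, LinearMap.zero_apply, eq_comm, smul_eq_zero_iff_left hv0] at h₃
  have h₄ := eq_zero_of_pow_eq_zero h₃
  rcases mul_eq_zero.mp h₄ with h | h
  · exact Or.inl h
  · exact Or.inr (eq_neg_of_add_eq_zero_left h)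

variable [FiniteDimensional ℂ V]

theorem re_eigenvalue_nonpos_of_isNilpotent_sl2Casimir (hHE : H * E - E * H = 2 * E)
    (hC : IsNilpotent (sl2Casimir H E F)) {μ : ℂ} (hμ : H.HasEigenvalue μ) : μ.re ≤ 0 := by
  have hfin := End.finite_hasEigenvalue H
  obtain ⟨ν, hν, hmax⟩ := hfin.exists_maximalFor Complex.re _ ⟨μ, hμ⟩
  obtain ⟨v, hv, hv0⟩ := hν.exists_hasEigenvector
  rw [End.mem_eigenspace_iff] at hv
  have hEv : E v = 0 := by
    by_contra hne
    have := hmax (hasEigenvalue_add_two hHE hv hne) (by simp)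
    simp at this
    linarith
  have hle : μ.re ≤ ν.re := by
    by_contra! hlt
    exact (hmax hμ hlt.le).not_gt hlt
  rcases eigenvalue_eq_of_isNilpotent_sl2Casimir hC hv hv0 hEv with rfl | rfl
  · simpa using hle
  · simp at hle; linarith

theorem e_eq_zero_of_isNilpotent_sl2Casimir (hHE : H * E - E * H = 2 * E)
    (hHF : H * F - F * H = -(2 * F)) (hEF : E * F - F * E = H)
    (hC : IsNilpotent (sl2Casimir H E F)) : E = 0 := by
  have hre {μ : ℂ} (hμ : H.HasEigenvalue μ) : μ.re = 0 := by
    refine le_antisymm (re_eigenvalue_nonpos_of_isNilpotent_sl2Casimir hHE hC hμ) ?_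
    obtain ⟨v, hv, hv0⟩ := hμ.exists_hasEigenvector
    have hneg : (-H).HasEigenvalue (-μ) := by
      refine End.hasEigenvalue_of_hasEigenvector (x := v) ⟨?_, hv0⟩
      rw [End.mem_eigenspace_iff] at hv ⊢
      simp [hv]
    have := re_eigenvalue_nonpos_of_isNilpotent_sl2Casimir (H := -H) (E := F) (F := E)
      (by rw [← neg_inj, ← hHF]; noncomm_ring) (by rwa [sl2Casimir_symm hEF]) hneg
    simpa using this
  have heig {μ : ℂ} (hμ : H.HasEigenvalue μ) : μ = 0 := by
    obtain ⟨v, hv, hv0⟩ := hμ.exists_hasEigenvector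
    rw [End.mem_eigenspace_iff] at hv
    have hEv : E v = 0 := by
      by_contra hne
      have := hre (hasEigenvalue_add_two hHE hv hne)
      simp [hre hμ] at this
    rcases eigenvalue_eq_of_isNilpotent_sl2Casimir hC hv hv0 hEv with h | rfl
    · exact h
    · simpa using hre hμ
  have hnil : ∀ v, ∃ n : ℕ, (H ^ n) v = 0 := by
    intro v
    have htop := End.iSup_maxGenEigenspace_eq_top H
    have hle : ⨆ μ, H.maxGenEigenspace μ ≤ H.maxGenEigenspace 0 := by
      refine iSup_le fun μ ↦ ?_
      by_cases hμ : H.HasEigenvalue μ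
      · rw [heig hμ]
      · have : H.maxGenEigenspace μ = ⊥ := by
          by_contra hne
          exact hμ (End.HasUnifEigenvalue.lt zero_lt_one hne)
        simp [this]
    have hv : v ∈ H.maxGenEigenspace 0 := hle (htop ▸ Submodule.mem_top)
    simpa [End.mem_maxGenEigenspace] using hv
  have hinj : Function.Injective (H + 2 : End ℂ V) := by
    rw [injective_iff_map_eq_zero]
    intro v hv
    by_contra hv0
    have h₂ : H.HasEigenvalue (-2) := by
      refine End.hasEigenvalue_of_hasEigenvector (x := v) ⟨?_, hv0⟩
      rw [LinearMap.add_apply] at hv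
      rw [End.mem_eigenspace_iff, eq_neg_of_add_eq_zero_left hv]
      simp [two_smul]
    simpa using heig h₂
  have hsurj := LinearMap.injective_iff_surjective.mp hinj
  obtain ⟨n, hn⟩ := End.isNilpotent_iff_of_finite.mpr hnil
  have hcomm : SemiconjBy E (H + 2) H := by
    rw [SemiconjBy, sub_eq_iff_eq_add.mp hHE]
    noncomm_ring
  ext v
  obtain ⟨w, rfl⟩ : ∃ w, ((H + 2) ^ n) w = v := by
    rw [End.coe_pow]
    exact hsurj.iterate n v
  rw [← End.mul_apply, (hcomm.pow_right n).eq, hn, zero_mul, LinearMap.zero_apply,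
    LinearMap.zero_apply]

theorem sl2_eq_zero_of_isNilpotent_sl2Casimir (hHE : H * E - E * H = 2 * E)
    (hHF : H * F - F * H = -(2 * F)) (hEF : E * F - F * E = H)
    (hC : IsNilpotent (sl2Casimir H E F)) : H = 0 ∧ E = 0 ∧ F = 0 := by
  have hE := e_eq_zero_of_isNilpotent_sl2Casimir hHE hHF hEF hC
  have hF := e_eq_zero_of_isNilpotent_sl2Casimir (H := -H) (E := F) (F := E)
    (by rw [← neg_inj, ← hHF]; noncomm_ring) (by rw [← hHE]; noncomm_ring)
    (by rw [← hEF]; abel) (by rwa [sl2Casimir_symm hEF])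
  exact ⟨by simp [← hEF, hE], hE, hF⟩

/-- For a finite-dimensional representation of `sl₂`, the invariants and the image of the Casimir
operator span the whole space. -/
theorem exists_eq_add_sl2Casimir (hHE : H * E - E * H = 2 * E)
    (hHF : H * F - F * H = -(2 * F)) (hEF : E * F - F * E = H) (y : V) :
    ∃ y₀ z : V, y = y₀ + sl2Casimir H E F z ∧ H y₀ = 0 ∧ E y₀ = 0 ∧ F y₀ = 0 := by
  set C := sl2Casimir H E F with hCdef
  obtain ⟨n, hn, hn1⟩ := (C.eventually_isCompl_ker_pow_range_pow.and
    (Filter.eventually_ge_atTop 1)).exists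
  have hmaps {A : End ℂ V} (hA : Commute C A) : ∀ v ∈ (C ^ n).ker, A v ∈ (C ^ n).ker := by
    intro v hv
    rw [LinearMap.mem_ker] at hv ⊢
    rw [← End.mul_apply, (hA.pow_left n).eq, End.mul_apply, hv, map_zero]
  have hE := commute_sl2Casimir_e hHE hEF
  have hF := commute_sl2Casimir_f hHF hEF
  have hH : Commute C H := by
    conv_rhs => rw [← hEF]
    exact (hE.mul_right hF).sub_right (hF.mul_right hE)
  obtain ⟨hH0, hE0, hF0⟩ := sl2_eq_zero_of_isNilpotent_sl2Casimir
    (H := H.restrict (hmaps hH)) (E := E.restrict (hmaps hE)) (F := F.restrict (hmaps hF))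
    (by ext v; simpa using LinearMap.congr_fun hHE v)
    (by ext v; simpa using LinearMap.congr_fun hHF v)
    (by ext v; simpa using LinearMap.congr_fun hEF v)
    (by
      refine ⟨n, ?_⟩
      have hres : sl2Casimir (H.restrict (hmaps hH)) (E.restrict (hmaps hE))
          (F.restrict (hmaps hF)) = C.restrict (hmaps (Commute.refl C)) := by
        ext v
        simp [hCdef, sl2Casimir]
      rw [hres, Module.End.pow_restrict]
      ext v
      simp)
  obtain ⟨y₀, hy₀, w, ⟨z, rfl⟩, rfl⟩ := Submodule.mem_sup.mp
    (hn.sup_eq_top ▸ Submodule.mem_top : y ∈ (C ^ n).ker ⊔ (C ^ n).range)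
  obtain ⟨m, rfl⟩ := Nat.exists_eq_add_of_le' hn1
  refine ⟨y₀, (C ^ m) z, by rw [pow_succ', End.mul_apply], ?_, ?_, ?_⟩
  · simpa using congrArg Subtype.val (LinearMap.congr_fun hH0 ⟨y₀, hy₀⟩)
  · simpa using congrArg Subtype.val (LinearMap.congr_fun hE0 ⟨y₀, hy₀⟩)
  · simpa using congrArg Subtype.val (LinearMap.congr_fun hF0 ⟨y₀, hy₀⟩)

end Sl2Representation

/-- The restriction of the Killing form of a finite-dimensional complex semisimple Lie algebra
to the centralizer of an `sl₂` triple is nondegenerate. -/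
theorem killingForm_nondegenerate_on_sl2_centralizer
    (L : Type*) [LieRing L] [LieAlgebra ℂ L] [FiniteDimensional ℂ L]
    [LieAlgebra.IsSemisimple ℂ L]
    (h e f : L)
    (hhe : ⁅h, e⁆ = (2 : ℂ) • e) (hhf : ⁅h, f⁆ = (-2 : ℂ) • f) (hef : ⁅e, f⁆ = h)
    (x : L) (hx : x ≠ 0)
    (hxh : ⁅h, x⁆ = 0) (hxe : ⁅e, x⁆ = 0) (hxf : ⁅f, x⁆ = 0) :
    ∃ y : L, ⁅h, y⁆ = 0 ∧ ⁅e, y⁆ = 0 ∧ ⁅f, y⁆ = 0 ∧ killingForm ℂ L x y ≠ 0 := by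
  have hbracket (a b : L) : LieAlgebra.ad ℂ L a * LieAlgebra.ad ℂ L b -
      LieAlgebra.ad ℂ L b * LieAlgebra.ad ℂ L a = LieAlgebra.ad ℂ L ⁅a, b⁆ := by
    ext
    simp
  have hinv {a : L} (ha : ⁅a, x⁆ = 0) (z : L) : killingForm ℂ L x ⁅a, z⁆ = 0 := by
    rw [killingForm, ← LieModule.traceForm_apply_lie_apply, ← lie_skew, ha]
    simp
  obtain ⟨y, hy⟩ : ∃ y, killingForm ℂ L x y ≠ 0 := by
    by_contra! hxy
    exact hx ((LieAlgebra.IsKilling.killingForm_nondegenerate ℂ L).1 x hxy)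
  obtain ⟨y₀, z, rfl, hH, hE, hF⟩ := exists_eq_add_sl2Casimir
    (H := LieAlgebra.ad ℂ L h) (E := LieAlgebra.ad ℂ L e) (F := LieAlgebra.ad ℂ L f)
    (by rw [hbracket, hhe]; ext; simp [two_smul])
    (by rw [hbracket, hhf]; ext; simp [two_smul])
    (by rw [hbracket, hef]) y
  refine ⟨y₀, hH, hE, hF, ?_⟩
  simpa [sl2Casimir, hinv hxh, hinv hxf] using hy
end
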